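/- Let g be measurable on (0,∞) with ∫_0^∞ |g(τ)|·(τ²+1) dτ < ∞ and let 0 < β < 2π. Then the function u(r,θ) = ∫_0^∞ 𝒦(r,τ)·(sinh(θτ)/sinh(βτ))·g(τ) dτ solves the boundary value problem for the equation r³·∂⁴u/∂r⁴ + r·∂⁴u/∂r²∂θ² + (11/2)·r²·∂³u/∂r³ + (1/2)·∂³u/∂r∂θ² + (11/2)·r·∂²u/∂r² + (1/2)·∂u/∂r − u = 0 on the wedge {(r,θ) : r > 0, 0 ≤ θ ≤ β}, subject to the boundary conditions u(r,0) = 0 and u(r,β) = (G g)(r) for all r > 0. -/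

import Mathlib

open MeasureTheory Set Filter Asymptotics

/-- Modified Bessel function of the second kind (integral representation, for Re z > 0). -/
noncomputable def besselK (nu z : ℂ) : ℂ :=
  ∫ t in Set.Ioi (0:ℝ), Complex.exp (-z * (Real.cosh t : ℂ)) * Complex.cosh (nu * (t : ℂ))

/-- The kernel 𝒦(x,τ) = ker²_{2iτ}(2(4x)^{1/4}) + kei²_{2iτ}(2(4x)^{1/4})
    = K_{2iτ}(2(4x)^{1/4}e^{iπ/4}) · K_{2iτ}(2(4x)^{1/4}e^{-iπ/4}), which is real. -/
noncomputable def kernelK (x τ : ℝ) : ℝ :=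
  (besselK (2 * Complex.I * (τ:ℂ))
      (((2 * (4*x) ^ ((1:ℝ)/4) : ℝ) : ℂ) * Complex.exp (Complex.I * (Real.pi:ℂ) / 4)) *
   besselK (2 * Complex.I * (τ:ℂ))
      (((2 * (4*x) ^ ((1:ℝ)/4) : ℝ) : ℂ) * Complex.exp (-(Complex.I * (Real.pi:ℂ)) / 4))).re

/-- K₀(y) = ∫₀^∞ exp(−y·cosh t) dt. -/
noncomputable def besselK0 (y : ℝ) : ℝ := ∫ t in Set.Ioi (0:ℝ), Real.exp (-y * Real.cosh t)

/-- K_{iτ}(x) = ∫₀^∞ exp(−x·cosh t)·cos(τt) dt (real-valued, purely imaginary order). -/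
noncomputable def besselKi (τ x : ℝ) : ℝ :=
  ∫ t in Set.Ioi (0:ℝ), Real.exp (-x * Real.cosh t) * Real.cos (τ * t)

/-- Modified Bessel function of the first kind I_ν(z) (power series). -/
noncomputable def besselI (nu z : ℂ) : ℂ :=
  ∑' n : ℕ, (z/2) ^ (nu + 2*(n:ℂ)) / ((n.factorial : ℂ) * Complex.Gamma (nu + (n:ℂ) + 1))

/-- B_ν(w) = ber²_ν(w) + bei²_ν(w) = I_ν(w·e^{iπ/4})·I_ν(w·e^{−iπ/4}). -/
noncomputable def kelvinB (nu w : ℂ) : ℂ :=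
  besselI nu (w * Complex.exp (Complex.I * (Real.pi:ℂ) / 4)) *
  besselI nu (w * Complex.exp (-(Complex.I * (Real.pi:ℂ)) / 4))

/-- Index transform (1.1): (F f)(τ) = ∫₀^∞ 𝒦(x,τ) f(x) dx. -/
noncomputable def indexF (f : ℝ → ℝ) (τ : ℝ) : ℝ := ∫ x in Set.Ioi (0:ℝ), kernelK x τ * f x

/-- Index transform (1.2): (G g)(x) = ∫₀^∞ 𝒦(x,τ) g(τ) dτ. -/
noncomputable def indexG (g : ℝ → ℝ) (x : ℝ) : ℝ := ∫ τ in Set.Ioi (0:ℝ), kernelK x τ * g τ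

/-- Index transform (1.2) for complex-valued densities. -/
noncomputable def indexGC (g : ℝ → ℂ) (x : ℝ) : ℂ :=
  ∫ τ in Set.Ioi (0:ℝ), (kernelK x τ : ℂ) * g τ

/-- Mellin transform of a real function. -/
noncomputable def mellinT (f : ℝ → ℝ) (s : ℂ) : ℂ :=
  ∫ x in Set.Ioi (0:ℝ), (f x : ℂ) * (x:ℂ) ^ (s - 1)

/-- Mellin transform of a complex function. -/
noncomputable def mellinC (F : ℝ → ℂ) (s : ℂ) : ℂ :=
  ∫ x in Set.Ioi (0:ℝ), F x * (x:ℂ) ^ (s - 1)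

/-- The L_{ν,p}(ℝ₊) norm. -/
noncomputable def Lnorm (ν p : ℝ) (f : ℝ → ℝ) : ℝ :=
  (∫ x in Set.Ioi (0:ℝ), |f x| ^ p * x ^ (ν*p - 1)) ^ (1/p)

/-- Euler beta function B(a,b) = Γ(a)Γ(b)/Γ(a+b). -/
noncomputable def betaFn (a b : ℝ) : ℝ := Real.Gamma a * Real.Gamma b / Real.Gamma (a+b)

/-- The function u(r,θ) of (4.3); the ratio sinh(θτ)/sinh(βτ) is interpreted as θ/β at τ = 0. -/
noncomputable def wedgeU (g : ℝ → ℝ) (β r θ : ℝ) : ℝ :=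
  ∫ τ in Set.Ioi (0:ℝ), kernelK r τ *
    (if τ = 0 then θ/β else Real.sinh (θ*τ)/Real.sinh (β*τ)) * g τ

/-- The primitive eighth root of unity `exp (iπ/4)`. -/
noncomputable def eighthRoot : ℂ := Complex.exp (Complex.I * (Real.pi : ℂ) / 4)

lemma eighthRoot_eq : eighthRoot = ((√2 / 2 : ℝ) : ℂ) + ((√2 / 2 : ℝ) : ℂ) * Complex.I := by
  have h : Complex.I * (Real.pi : ℂ) / 4 = ((Real.pi / 4 : ℝ) : ℂ) * Complex.I := by
    push_cast; ring
  rw [eighthRoot, h, Complex.exp_mul_I, ← Complex.ofReal_cos, ← Complex.ofReal_sin,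
    Real.cos_pi_div_four, Real.sin_pi_div_four]

lemma eighthRoot_sq : eighthRoot ^ 2 = Complex.I := by
  rw [eighthRoot, ← Complex.exp_nat_mul]
  have h : ((2 : ℕ) : ℂ) * (Complex.I * (Real.pi : ℂ) / 4) = (Real.pi : ℂ) / 2 * Complex.I := by
    push_cast; ring
  rw [h, Complex.exp_pi_div_two_mul_I]

lemma norm_eighthRoot : ‖eighthRoot‖ = 1 := by
  have h : Complex.I * (Real.pi : ℂ) / 4 = ((Real.pi / 4 : ℝ) : ℂ) * Complex.I := by
    push_cast; ring
  rw [eighthRoot, h, Complex.norm_exp_ofReal_mul_I]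

lemma conj_eighthRoot :
    (starRingEnd ℂ) eighthRoot = Complex.exp (-(Complex.I * (Real.pi : ℂ)) / 4) := by
  rw [eighthRoot, ← Complex.exp_conj]
  congr 1
  simp [map_ofNat]

lemma sq_div_four_le_cosh (t : ℝ) : t ^ 2 / 4 ≤ Real.cosh t := by
  rw [← Real.cosh_abs, Real.cosh_eq]
  have h1 := Real.quadratic_le_exp_of_nonneg (abs_nonneg t)
  have h2 := Real.exp_pos (-|t|)
  have h3 := sq_abs t
  have h4 := abs_nonneg t
  linarith

lemma integrable_cosh_pow_mul_exp_neg_mul_cosh (k : ℕ) {a : ℝ} (ha : 0 < a) :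
    Integrable (fun t : ℝ => Real.cosh t ^ k * Real.exp (-(a * Real.cosh t))) := by
  have hg := (integrable_exp_neg_mul_sq (b := a / 8) (by positivity)).const_mul
    (k.factorial * (2 / a) ^ k)
  refine hg.mono' (by fun_prop) (Eventually.of_forall fun t => ?_)
  have hc := Real.cosh_pos t
  rw [Real.norm_of_nonneg (by positivity)]
  have h1 : Real.cosh t ^ k ≤ k.factorial * (2 / a) ^ k * Real.exp (a / 2 * Real.cosh t) := by
    have h := Real.pow_div_factorial_le_exp (a / 2 * Real.cosh t) (by positivity) k
    rw [div_le_iff₀ (by positivity)] at h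
    calc Real.cosh t ^ k = (2 / a) ^ k * (a / 2 * Real.cosh t) ^ k := by
          rw [← mul_pow]; congr 1; field_simp
      _ ≤ (2 / a) ^ k * (Real.exp (a / 2 * Real.cosh t) * k.factorial) := by gcongr
      _ = _ := by ring
  calc Real.cosh t ^ k * Real.exp (-(a * Real.cosh t))
      ≤ k.factorial * (2 / a) ^ k * Real.exp (a / 2 * Real.cosh t)
          * Real.exp (-(a * Real.cosh t)) := by gcongr
    _ = k.factorial * (2 / a) ^ k * Real.exp (-(a / 2) * Real.cosh t) := by
        rw [mul_assoc, ← Real.exp_add]; congr 2; ring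
    _ ≤ k.factorial * (2 / a) ^ k * Real.exp (-(a / 8) * t ^ 2) := by
        have := sq_div_four_le_cosh t
        gcongr ?_ * Real.exp ?_
        nlinarith

/-- The entire integrand `exp (-w e^{iπ/4} cosh ζ + 2iτζ)`. -/
noncomputable def besselIntegrand (w τ : ℝ) (ζ : ℂ) : ℂ :=
  Complex.exp (-((w : ℂ) * eighthRoot * Complex.cosh ζ) + 2 * Complex.I * (τ : ℂ) * ζ)

/-- The point `t + iσ`. -/
noncomputable def shiftedPt (σ t : ℝ) : ℂ := (t : ℂ) + (σ : ℂ) * Complex.I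

lemma continuous_besselIntegrand_shiftedPt :
    Continuous (fun p : ℝ × ℝ × ℝ × ℝ => besselIntegrand p.1 p.2.1 (shiftedPt p.2.2.1 p.2.2.2)) := by
  unfold besselIntegrand shiftedPt
  fun_prop

lemma cosh_shiftedPt (σ t : ℝ) : Complex.cosh (shiftedPt σ t) =
    ((Real.cosh t * Real.cos σ : ℝ) : ℂ) + ((Real.sinh t * Real.sin σ : ℝ) : ℂ) * Complex.I := by
  rw [shiftedPt, Complex.cosh_add, Complex.cosh_mul_I, Complex.sinh_mul_I]
  push_cast; ring

lemma sinh_shiftedPt (σ t : ℝ) : Complex.sinh (shiftedPt σ t) =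
    ((Real.sinh t * Real.cos σ : ℝ) : ℂ) + ((Real.cosh t * Real.sin σ : ℝ) : ℂ) * Complex.I := by
  rw [shiftedPt, Complex.sinh_add, Complex.cosh_mul_I, Complex.sinh_mul_I]
  push_cast; ring

lemma norm_cosh_shiftedPt_le (σ t : ℝ) : ‖Complex.cosh (shiftedPt σ t)‖ ≤ Real.cosh t := by
  rw [cosh_shiftedPt, Complex.norm_add_mul_I, Real.sqrt_le_left (Real.cosh_pos t).le]
  nlinarith [Real.cosh_sq t, Real.sin_sq_add_cos_sq σ, sq_nonneg (Real.sin σ)]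

lemma norm_sinh_shiftedPt_le (σ t : ℝ) : ‖Complex.sinh (shiftedPt σ t)‖ ≤ Real.cosh t := by
  rw [sinh_shiftedPt, Complex.norm_add_mul_I, Real.sqrt_le_left (Real.cosh_pos t).le]
  nlinarith [Real.cosh_sq t, Real.sin_sq_add_cos_sq σ, sq_nonneg (Real.cos σ)]

lemma norm_besselIntegrand_le {w : ℝ} (hw : 0 ≤ w) (τ : ℝ) {σ : ℝ} (hσ : |σ| ≤ 1 / 2) (t : ℝ) :
    ‖besselIntegrand w τ (shiftedPt σ t)‖
      ≤ Real.exp (-(2 * τ * σ)) * Real.exp (-(w / 4 * Real.cosh t)) := by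
  rw [besselIntegrand, Complex.norm_exp, ← Real.exp_add, Real.exp_le_exp, cosh_shiftedPt,
    eighthRoot_eq, shiftedPt]
  have hre : (-((w : ℂ) * (((√2 / 2 : ℝ) : ℂ) + ((√2 / 2 : ℝ) : ℂ) * Complex.I) *
      (((Real.cosh t * Real.cos σ : ℝ) : ℂ) +
        ((Real.sinh t * Real.sin σ : ℝ) : ℂ) * Complex.I)) +
      2 * Complex.I * (τ : ℂ) * ((t : ℂ) + (σ : ℂ) * Complex.I)).re
      = -(w * (√2 / 2 * (Real.cosh t * Real.cos σ - Real.sinh t * Real.sin σ))) - 2 * τ * σ := by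
    simp only [Complex.add_re, Complex.neg_re, Complex.mul_re, Complex.mul_im, Complex.add_im,
      Complex.ofReal_re, Complex.ofReal_im, Complex.I_re, Complex.I_im, Complex.re_ofNat,
      Complex.im_ofNat]
    ring
  rw [hre]
  have hcos : (7 / 8 : ℝ) ≤ Real.cos σ := by
    have h1 := Real.one_sub_sq_div_two_le_cos (x := σ)
    have h2 : σ ^ 2 ≤ (1 / 2) ^ 2 := sq_le_sq' (abs_le.1 hσ).1 (abs_le.1 hσ).2
    linarith
  have hsin : |Real.sin σ| ≤ 1 / 2 := (Real.abs_sin_le_abs (x := σ)).trans hσ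
  have hsh : |Real.sinh t| ≤ Real.cosh t := by
    apply abs_le_of_sq_le_sq _ (Real.cosh_pos t).le
    rw [Real.cosh_sq]; linarith
  have hprod : Real.sinh t * Real.sin σ ≤ Real.cosh t * (1 / 2) :=
    (le_abs_self _).trans (by rw [abs_mul]; gcongr)
  have hch : Real.cosh t * (7 / 8) ≤ Real.cosh t * Real.cos σ := by
    have := Real.cosh_pos t
    gcongr
  have h2 : (7 / 10 : ℝ) ≤ √2 / 2 := by
    have : (7 / 5 : ℝ) ≤ √2 := Real.le_sqrt_of_sq_le (by norm_num)
    linarith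
  have h3 : 1 / 4 * Real.cosh t
      ≤ √2 / 2 * (Real.cosh t * Real.cos σ - Real.sinh t * Real.sin σ) := by
    have := Real.cosh_pos t
    calc 1 / 4 * Real.cosh t ≤ 7 / 10 * (Real.cosh t * (3 / 8)) := by linarith
      _ ≤ _ := by gcongr; linarith
  nlinarith

lemma integrable_mul_besselIntegrand {w : ℝ} (hw : 0 < w) (τ : ℝ) {σ : ℝ} (hσ : |σ| ≤ 1 / 2)
    {q : ℝ → ℂ} (hq : Continuous q) (C : ℝ) (k : ℕ) (hqb : ∀ t, ‖q t‖ ≤ C * Real.cosh t ^ k) :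
    Integrable (fun t : ℝ => q t * besselIntegrand w τ (shiftedPt σ t)) := by
  have hg := (integrable_cosh_pow_mul_exp_neg_mul_cosh k (a := w / 4) (by positivity)).const_mul
    (C * Real.exp (-(2 * τ * σ)))
  have hc : Continuous (fun t : ℝ => besselIntegrand w τ (shiftedPt σ t)) :=
    continuous_besselIntegrand_shiftedPt.comp (by fun_prop :
      Continuous fun t : ℝ => ((w, τ, σ, t) : ℝ × ℝ × ℝ × ℝ))
  refine hg.mono' (hq.mul hc).aestronglyMeasurable (Eventually.of_forall fun t => ?_)
  rw [norm_mul]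
  have h0 := (norm_nonneg (q t)).trans (hqb t)
  calc ‖q t‖ * ‖besselIntegrand w τ (shiftedPt σ t)‖
      ≤ (C * Real.cosh t ^ k) * (Real.exp (-(2 * τ * σ)) * Real.exp (-(w / 4 * Real.cosh t))) := by
        gcongr
        · exact hqb t
        · exact norm_besselIntegrand_le hw.le τ hσ t
    _ = _ := by ring

lemma hasDerivAt_besselIntegrand (w τ : ℝ) (ζ : ℂ) :
    HasDerivAt (besselIntegrand w τ)
      ((-((w : ℂ) * eighthRoot * Complex.sinh ζ) + 2 * Complex.I * (τ : ℂ))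
        * besselIntegrand w τ ζ) ζ := by
  have h1 := ((Complex.hasDerivAt_cosh ζ).const_mul ((w : ℂ) * eighthRoot)).neg
  have h2 := (hasDerivAt_id ζ).const_mul (2 * Complex.I * (τ : ℂ))
  have h := (h1.add h2).cexp
  refine h.congr_deriv ?_
  simp [besselIntegrand]
  ring

lemma hasDerivAt_shiftedPt_right (σ t : ℝ) : HasDerivAt (fun s : ℝ => shiftedPt σ s) 1 t := by
  unfold shiftedPt
  exact (Complex.ofRealCLM.hasDerivAt (x := t)).add_const _

lemma hasDerivAt_shiftedPt_left (σ t : ℝ) :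
    HasDerivAt (fun s : ℝ => shiftedPt s t) Complex.I σ := by
  unfold shiftedPt
  simpa using ((Complex.ofRealCLM.hasDerivAt (x := σ)).mul_const Complex.I).const_add (t : ℂ)

lemma continuous_shiftedPt (σ : ℝ) : Continuous (shiftedPt σ) := by
  unfold shiftedPt; fun_prop

lemma norm_bessel_factor_le {w : ℝ} (hw : 0 ≤ w) (τ σ t : ℝ) :
    ‖-((w : ℂ) * eighthRoot * Complex.sinh (shiftedPt σ t)) + 2 * Complex.I * (τ : ℂ)‖
      ≤ (w + 2 * |τ|) * Real.cosh t ^ 1 := by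
  have h1 := Real.one_le_cosh t
  have h2 := norm_sinh_shiftedPt_le σ t
  refine (norm_add_le _ _).trans ?_
  simp only [norm_neg, norm_mul, norm_eighthRoot, Complex.norm_real, Complex.norm_I,
    Complex.norm_ofNat, Real.norm_eq_abs, abs_of_nonneg hw, pow_one, mul_one]
  nlinarith [mul_le_mul_of_nonneg_left h2 hw, abs_nonneg τ]

/-- The integral of `besselIntegrand` does not depend on the height of the horizontal line. -/
lemma integral_besselIntegrand_shift {w : ℝ} (hw : 0 < w) (τ : ℝ) :
    ∫ t : ℝ, besselIntegrand w τ (shiftedPt (1 / 4) t)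
      = ∫ t : ℝ, besselIntegrand w τ (shiftedPt 0 t) := by
  have hq : ∀ σ : ℝ, Continuous fun t : ℝ =>
      -((w : ℂ) * eighthRoot * Complex.sinh (shiftedPt σ t)) + 2 * Complex.I * (τ : ℂ) := by
    intro σ
    have := continuous_shiftedPt σ
    fun_prop
  have integ : ∀ σ : ℝ, |σ| ≤ 1 / 2 →
      Integrable (fun t : ℝ => besselIntegrand w τ (shiftedPt σ t)) := by
    intro σ hσ
    simpa using integrable_mul_besselIntegrand hw τ hσ (q := fun _ => 1) continuous_const 1 0
      (by simp)
  have key : ∀ σ ∈ Ioo (-(1 / 2) : ℝ) (1 / 2), HasDerivAt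
      (fun s : ℝ => ∫ t : ℝ, besselIntegrand w τ (shiftedPt s t)) 0 σ := by
    intro σ hσ
    have hσ' : |σ| ≤ 1 / 2 := abs_le.2 ⟨hσ.1.le, hσ.2.le⟩
    have hz : ∫ t : ℝ, (-((w : ℂ) * eighthRoot * Complex.sinh (shiftedPt σ t))
        + 2 * Complex.I * (τ : ℂ)) * besselIntegrand w τ (shiftedPt σ t) = 0 := by
      refine integral_eq_zero_of_hasDerivAt_of_integrable
        (f := fun t : ℝ => besselIntegrand w τ (shiftedPt σ t)) (fun t => ?_)
        (integrable_mul_besselIntegrand hw τ hσ' (hq σ) _ 1 (norm_bessel_factor_le hw.le τ σ))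
        (integ σ hσ')
      refine ((hasDerivAt_besselIntegrand w τ _).comp t
        (hasDerivAt_shiftedPt_right σ t)).congr_deriv ?_
      ring
    have hd := (hasDerivAt_integral_of_dominated_loc_of_deriv_le (μ := volume)
      (F := fun (s t : ℝ) => besselIntegrand w τ (shiftedPt s t))
      (F' := fun (s t : ℝ) => Complex.I * ((-((w : ℂ) * eighthRoot * Complex.sinh (shiftedPt s t))
        + 2 * Complex.I * (τ : ℂ)) * besselIntegrand w τ (shiftedPt s t)))
      (bound := fun t => (w + 2 * |τ|) * Real.exp |τ| *
        (Real.cosh t ^ 1 * Real.exp (-(w / 4 * Real.cosh t))))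
      (x₀ := σ) (Ioo_mem_nhds hσ.1 hσ.2) ?_ (integ σ hσ') ?_ ?_ ?_ ?_).2
    · rwa [integral_const_mul, hz, mul_zero] at hd
    · exact Eventually.of_forall fun s => (continuous_besselIntegrand_shiftedPt.comp (by fun_prop :
        Continuous fun t : ℝ => ((w, τ, s, t) : ℝ × ℝ × ℝ × ℝ))).aestronglyMeasurable
    · exact ((integrable_mul_besselIntegrand hw τ hσ' (hq σ) _ 1
        (norm_bessel_factor_le hw.le τ σ)).const_mul Complex.I).aestronglyMeasurable
    · refine Eventually.of_forall fun t s hs => ?_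
      have hs' : |s| ≤ 1 / 2 := abs_le.2 ⟨hs.1.le, hs.2.le⟩
      rw [norm_mul, norm_mul, Complex.norm_I, one_mul]
      have h1 := norm_bessel_factor_le hw.le τ s t
      have h2 := norm_besselIntegrand_le hw.le τ hs' t
      have h3 : Real.exp (-(2 * τ * s)) ≤ Real.exp |τ| := by
        rw [Real.exp_le_exp]
        calc -(2 * τ * s) ≤ |2 * τ * s| := neg_le_abs _
          _ = 2 * |τ| * |s| := by rw [abs_mul, abs_mul, abs_two]
          _ ≤ 2 * |τ| * (1 / 2) := by gcongr
          _ = |τ| := by ring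
      have h4 := Real.cosh_pos t
      calc _ ≤ ((w + 2 * |τ|) * Real.cosh t ^ 1) *
            (Real.exp (-(2 * τ * s)) * Real.exp (-(w / 4 * Real.cosh t))) := by gcongr
        _ ≤ ((w + 2 * |τ|) * Real.cosh t ^ 1) *
            (Real.exp |τ| * Real.exp (-(w / 4 * Real.cosh t))) := by gcongr
        _ = _ := by ring
    · exact (integrable_cosh_pow_mul_exp_neg_mul_cosh 1 (by positivity)).const_mul _
    · refine Eventually.of_forall fun t s _ => ?_
      refine ((hasDerivAt_besselIntegrand w τ _).comp s
        (hasDerivAt_shiftedPt_left s t)).congr_deriv ?_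
      ring
  have hsub : ∀ x ∈ Icc (0 : ℝ) (1 / 4), x ∈ Ioo (-(1 / 2) : ℝ) (1 / 2) :=
    fun x hx => ⟨by linarith [hx.1], by linarith [hx.2]⟩
  exact constant_of_has_deriv_right_zero (a := 0) (b := 1 / 4)
    (fun x hx => (key x (hsub x hx)).continuousAt.continuousWithinAt)
    (fun x hx => (key x (hsub x (Ico_subset_Icc_self hx))).hasDerivWithinAt) (1 / 4)
    ⟨by norm_num, le_rfl⟩

/-- The `k`-th derivative in `w` of `∫ exp (-w e^{iπ/4} cosh ζ + 2iτζ) dζ` over `Im ζ = 1/4`. -/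
noncomputable def besselMoment (k : ℕ) (w τ : ℝ) : ℂ :=
  ∫ t : ℝ, (-(eighthRoot * Complex.cosh (shiftedPt (1 / 4) t))) ^ k
    * besselIntegrand w τ (shiftedPt (1 / 4) t)

lemma norm_moment_factor_le (k : ℕ) (σ t : ℝ) :
    ‖(-(eighthRoot * Complex.cosh (shiftedPt σ t))) ^ k‖ ≤ 1 * Real.cosh t ^ k := by
  rw [norm_pow, norm_neg, norm_mul, norm_eighthRoot, one_mul, one_mul]
  gcongr
  exact norm_cosh_shiftedPt_le σ t

lemma continuous_moment_factor (k : ℕ) (σ : ℝ) :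
    Continuous fun t : ℝ => (-(eighthRoot * Complex.cosh (shiftedPt σ t))) ^ k := by
  have := continuous_shiftedPt σ
  fun_prop

lemma integrable_besselMoment (k : ℕ) {w : ℝ} (hw : 0 < w) (τ : ℝ) :
    Integrable fun t : ℝ => (-(eighthRoot * Complex.cosh (shiftedPt (1 / 4) t))) ^ k
      * besselIntegrand w τ (shiftedPt (1 / 4) t) :=
  integrable_mul_besselIntegrand hw τ (by rw [abs_of_pos] <;> norm_num)
    (continuous_moment_factor k _) 1 k (norm_moment_factor_le k _)

lemma norm_moment_integrand_le (k : ℕ) {w₀ w : ℝ} (hw₀ : 0 < w₀) (hw : w₀ ≤ w) (τ t : ℝ) :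
    ‖(-(eighthRoot * Complex.cosh (shiftedPt (1 / 4) t))) ^ k
      * besselIntegrand w τ (shiftedPt (1 / 4) t)‖
      ≤ Real.exp (-(τ / 2)) * (Real.cosh t ^ k * Real.exp (-(w₀ / 4 * Real.cosh t))) := by
  have h1 := norm_moment_factor_le k (1 / 4) t
  have h2 := norm_besselIntegrand_le (hw₀.le.trans hw) τ (σ := 1 / 4)
    (by rw [abs_of_pos] <;> norm_num) t
  have h3 := Real.cosh_pos t
  rw [norm_mul]
  calc _ ≤ (1 * Real.cosh t ^ k) *
        (Real.exp (-(2 * τ * (1 / 4))) * Real.exp (-(w / 4 * Real.cosh t))) := by gcongr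
    _ ≤ (1 * Real.cosh t ^ k) *
        (Real.exp (-(2 * τ * (1 / 4))) * Real.exp (-(w₀ / 4 * Real.cosh t))) := by gcongr
    _ = _ := by
      rw [show 2 * τ * (1 / 4) = τ / 2 by ring]; ring

lemma exists_norm_besselMoment_le (k : ℕ) {w₀ : ℝ} (hw₀ : 0 < w₀) :
    ∃ C, 0 ≤ C ∧ ∀ w, w₀ ≤ w → ∀ τ, ‖besselMoment k w τ‖ ≤ C * Real.exp (-(τ / 2)) := by
  refine ⟨∫ t : ℝ, Real.cosh t ^ k * Real.exp (-(w₀ / 4 * Real.cosh t)),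
    integral_nonneg fun t => ?_, fun w hw τ => ?_⟩
  · have := Real.cosh_pos t
    positivity
  · rw [mul_comm, ← integral_const_mul]
    exact norm_integral_le_of_norm_le
      ((integrable_cosh_pow_mul_exp_neg_mul_cosh k (by positivity)).const_mul _)
      (Eventually.of_forall fun t => norm_moment_integrand_le k hw₀ hw τ t)

lemma hasDerivAt_besselIntegrand_left (w τ : ℝ) (ζ : ℂ) :
    HasDerivAt (fun v : ℝ => besselIntegrand v τ ζ)
      (-(eighthRoot * Complex.cosh ζ) * besselIntegrand w τ ζ) w := by
  unfold besselIntegrand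
  have h1 := ((((Complex.ofRealCLM.hasDerivAt (x := w)).mul_const eighthRoot).mul_const
    (Complex.cosh ζ)).neg.add_const (2 * Complex.I * (τ : ℂ) * ζ)).cexp
  refine h1.congr_deriv ?_
  simp
  ring

lemma hasDerivAt_besselMoment (k : ℕ) {w : ℝ} (hw : 0 < w) (τ : ℝ) :
    HasDerivAt (fun v => besselMoment k v τ) (besselMoment (k + 1) w τ) w := by
  refine (hasDerivAt_integral_of_dominated_loc_of_deriv_le (μ := volume)
    (F := fun v t => (-(eighthRoot * Complex.cosh (shiftedPt (1 / 4) t))) ^ k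
      * besselIntegrand v τ (shiftedPt (1 / 4) t))
    (F' := fun v t => (-(eighthRoot * Complex.cosh (shiftedPt (1 / 4) t))) ^ (k + 1)
      * besselIntegrand v τ (shiftedPt (1 / 4) t))
    (bound := fun t => Real.exp (-(τ / 2)) *
      (Real.cosh t ^ (k + 1) * Real.exp (-(w / 2 / 4 * Real.cosh t))))
    (Ioi_mem_nhds (half_lt_self hw)) ?_ (integrable_besselMoment k hw τ)
    (integrable_besselMoment (k + 1) hw τ).aestronglyMeasurable ?_ ?_ ?_).2
  · filter_upwards [Ioi_mem_nhds hw] with v hv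
    exact (integrable_besselMoment k hv τ).aestronglyMeasurable
  · exact Eventually.of_forall fun t v hv =>
      norm_moment_integrand_le (k + 1) (half_pos hw) (mem_Ioi.1 hv).le τ t
  · exact (integrable_cosh_pow_mul_exp_neg_mul_cosh _ (by positivity)).const_mul _
  · refine Eventually.of_forall fun t v _ => ?_
    refine ((hasDerivAt_besselIntegrand_left v τ _).const_mul _).congr_deriv ?_
    ring

/-- The modified Bessel equation in moment form. -/
lemma besselMoment_ode {w : ℝ} (hw : 0 < w) (τ : ℝ) :
    (w : ℂ) ^ 2 * besselMoment 2 w τ + (w : ℂ) * besselMoment 1 w τ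
      = (Complex.I * (w : ℂ) ^ 2 - 4 * (τ : ℂ) ^ 2) * besselMoment 0 w τ := by
  have hi := fun k => integrable_besselMoment k hw τ
  have hσ : |(1 / 4 : ℝ)| ≤ 1 / 2 := by rw [abs_of_pos] <;> norm_num
  set G : ℝ → ℂ := fun t =>
    (-((w : ℂ) * eighthRoot * Complex.sinh (shiftedPt (1 / 4) t)) + -(2 * Complex.I * (τ : ℂ)))
      * besselIntegrand w τ (shiftedPt (1 / 4) t) with hG
  have hGi : Integrable G := by
    refine integrable_mul_besselIntegrand hw τ hσ ?_ (w + 2 * |τ|) 1 fun t => ?_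
    · have := continuous_shiftedPt (1 / 4)
      fun_prop
    · have h := norm_bessel_factor_le hw.le (-τ) (1 / 4) t
      simpa using h
  have hd : ∀ t, HasDerivAt G
      ((w : ℂ) ^ 2 * ((-(eighthRoot * Complex.cosh (shiftedPt (1 / 4) t))) ^ 2
        * besselIntegrand w τ (shiftedPt (1 / 4) t))
      + (w : ℂ) * ((-(eighthRoot * Complex.cosh (shiftedPt (1 / 4) t))) ^ 1
        * besselIntegrand w τ (shiftedPt (1 / 4) t))
      - (Complex.I * (w : ℂ) ^ 2 - 4 * (τ : ℂ) ^ 2) *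
        ((-(eighthRoot * Complex.cosh (shiftedPt (1 / 4) t))) ^ 0
        * besselIntegrand w τ (shiftedPt (1 / 4) t))) t := by
    intro t
    have hs : HasDerivAt (fun ζ : ℂ =>
        (-((w : ℂ) * eighthRoot * Complex.sinh ζ) + -(2 * Complex.I * (τ : ℂ)))
          * besselIntegrand w τ ζ) _ (shiftedPt (1 / 4) t) :=
      ((((Complex.hasDerivAt_sinh _).const_mul ((w : ℂ) * eighthRoot)).neg).add_const _).mul
        (hasDerivAt_besselIntegrand w τ _)
    refine (hs.comp t (hasDerivAt_shiftedPt_right (1 / 4) t)).congr_deriv ?_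
    have h1 := Complex.cosh_sq (shiftedPt (1 / 4) t)
    have h2 := eighthRoot_sq
    have h3 := Complex.I_sq
    simp only [Pi.neg_apply]
    linear_combination besselIntegrand w τ (shiftedPt (1 / 4) t) *
      (-(w : ℂ) ^ 2 * eighthRoot ^ 2 * h1 - (w : ℂ) ^ 2 * h2 - 4 * (τ : ℂ) ^ 2 * h3)
  have hz := integral_eq_zero_of_hasDerivAt_of_integrable hd
    ((((hi 2).const_mul _).add ((hi 1).const_mul _)).sub ((hi 0).const_mul _)) hGi
  have hi21 : Integrable fun t : ℝ => (w : ℂ) ^ 2 *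
        ((-(eighthRoot * Complex.cosh (shiftedPt (1 / 4) t))) ^ 2
        * besselIntegrand w τ (shiftedPt (1 / 4) t))
      + (w : ℂ) * ((-(eighthRoot * Complex.cosh (shiftedPt (1 / 4) t))) ^ 1
        * besselIntegrand w τ (shiftedPt (1 / 4) t)) :=
    ((hi 2).const_mul _).add ((hi 1).const_mul _)
  rw [integral_sub hi21 ((hi 0).const_mul _), integral_add ((hi 2).const_mul _) ((hi 1).const_mul _),
    integral_const_mul,
    integral_const_mul, integral_const_mul] at hz
  exact sub_eq_zero.1 hz

lemma besselMoment_zero_eq {w : ℝ} (hw : 0 < w) (τ : ℝ) :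
    besselMoment 0 w τ = 2 * besselK (2 * Complex.I * (τ : ℂ)) ((w : ℂ) * eighthRoot) := by
  have h0 : besselMoment 0 w τ = ∫ t : ℝ, besselIntegrand w τ (shiftedPt 0 t) := by
    rw [← integral_besselIntegrand_shift hw]
    simp [besselMoment]
  have integ : Integrable (fun t : ℝ => besselIntegrand w τ (shiftedPt 0 t)) := by
    simpa using integrable_mul_besselIntegrand hw τ (σ := 0) (by simp) (q := fun _ => 1)
      continuous_const 1 0 (by simp)
  have hneg := integral_comp_neg_Ioi 0 fun t : ℝ => besselIntegrand w τ (shiftedPt 0 t)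
  rw [neg_zero] at hneg
  rw [h0, ← intervalIntegral.integral_Iic_add_Ioi (b := 0) integ.integrableOn integ.integrableOn,
    ← hneg, ← integral_add integ.comp_neg.integrableOn integ.integrableOn, besselK,
    ← integral_const_mul]
  refine integral_congr_ae (Eventually.of_forall fun t => ?_)
  have e1 : ∀ s : ℝ, besselIntegrand w τ (shiftedPt 0 s) =
      Complex.exp (-((w : ℂ) * eighthRoot) * (Real.cosh s : ℂ)) *
        Complex.exp (2 * Complex.I * (τ : ℂ) * (s : ℂ)) := by
    intro s
    rw [besselIntegrand, shiftedPt, ← Complex.exp_add, Complex.ofReal_cosh]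
    simp
  simp only [e1, Real.cosh_neg, Complex.cosh]
  push_cast
  ring_nf

lemma besselK_conj (τ : ℝ) (z : ℂ) :
    besselK (2 * Complex.I * (τ : ℂ)) ((starRingEnd ℂ) z)
      = (starRingEnd ℂ) (besselK (2 * Complex.I * (τ : ℂ)) z) := by
  rw [besselK, besselK, ← integral_conj]
  refine integral_congr_ae (Eventually.of_forall fun t => ?_)
  simp only [map_mul, ← Complex.exp_conj, ← Complex.cosh_conj, map_neg, Complex.conj_ofReal,
    Complex.conj_I, map_ofNat]
  rw [← Complex.cosh_neg (2 * -Complex.I * (τ : ℂ) * (t : ℂ))]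
  ring_nf

/-- The argument `2 (4r)^{1/4}` of the Bessel functions in the kernel. -/
noncomputable def kernelArg (r : ℝ) : ℝ := 2 * (4 * r) ^ ((1 : ℝ) / 4)

lemma kernelArg_pos {r : ℝ} (hr : 0 < r) : 0 < kernelArg r := by
  unfold kernelArg; positivity

lemma kernelArg_pow_four {r : ℝ} (hr : 0 < r) : kernelArg r ^ 4 = 64 * r := by
  rw [kernelArg, mul_pow, ← Real.rpow_natCast ((4 * r) ^ ((1 : ℝ) / 4)),
    ← Real.rpow_mul (by positivity)]
  norm_num
  ring

lemma hasDerivAt_kernelArg {r : ℝ} (hr : 0 < r) :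
    HasDerivAt kernelArg (kernelArg r / (4 * r)) r := by
  unfold kernelArg
  have h := (((hasDerivAt_id r).const_mul 4).rpow_const (p := (1 : ℝ) / 4)
    (Or.inl (by simp [hr.ne']))).const_mul 2
  refine h.congr_deriv ?_
  rw [Real.rpow_sub_one (by simp [hr.ne'])]
  simp
  field_simp

lemma kernelK_eq {r : ℝ} (hr : 0 < r) (τ : ℝ) :
    kernelK r τ = Complex.normSq (besselMoment 0 (kernelArg r) τ) / 4 := by
  have h1 : ((2 * (4 * r) ^ ((1 : ℝ) / 4) : ℝ) : ℂ) *
      Complex.exp (-(Complex.I * (Real.pi : ℂ)) / 4)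
      = (starRingEnd ℂ) ((kernelArg r : ℂ) * eighthRoot) := by
    rw [map_mul, conj_eighthRoot, Complex.conj_ofReal, kernelArg]
  rw [kernelK, h1, besselK_conj, besselMoment_zero_eq (kernelArg_pos hr)]
  change (besselK _ ((kernelArg r : ℂ) * eighthRoot) * _).re = _
  rw [Complex.mul_conj, Complex.ofReal_re, Complex.normSq_mul]
  norm_num

lemma measurable_besselMoment (k : ℕ) (w : ℝ) : Measurable fun τ => besselMoment k w τ := by
  have hc : Continuous (Function.uncurry fun (τ t : ℝ) =>
      (-(eighthRoot * Complex.cosh (shiftedPt (1 / 4) t))) ^ k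
        * besselIntegrand w τ (shiftedPt (1 / 4) t)) := by
    unfold Function.uncurry besselIntegrand shiftedPt
    fun_prop
  exact hc.stronglyMeasurable.integral_prod_right.measurable

/-- `X r τ` is measurable in `τ` and `O(exp (-ητ))` for every `η < 1`, locally uniformly in
`r > 0`. -/
structure RapidDecay (X : ℝ → ℝ → ℝ) : Prop where
  measurable : ∀ r, 0 < r → Measurable (X r)
  bound : ∀ η < 1, ∀ a b, 0 < a → ∃ C, 0 ≤ C ∧ ∀ r ∈ Icc a b, ∀ τ, 0 < τ →
    |X r τ| ≤ C * Real.exp (-(η * τ))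

/-- `X r τ` is measurable in `τ` and `O(exp (-τ/2))`, locally uniformly in `r > 0`. -/
structure HalfDecay (X : ℝ → ℝ → ℝ) : Prop where
  measurable : ∀ r, 0 < r → Measurable (X r)
  bound : ∀ a b, 0 < a → ∃ C, 0 ≤ C ∧ ∀ r ∈ Icc a b, ∀ τ, 0 < τ →
    |X r τ| ≤ C * Real.exp (-(τ / 2))

lemma HalfDecay.mul {X Y : ℝ → ℝ → ℝ} (hX : HalfDecay X) (hY : HalfDecay Y) :
    RapidDecay fun r τ => X r τ * Y r τ := by
  refine ⟨fun r hr => (hX.measurable r hr).mul (hY.measurable r hr), fun η hη a b ha => ?_⟩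
  obtain ⟨C, hC, h1⟩ := hX.bound a b ha
  obtain ⟨D, hD, h2⟩ := hY.bound a b ha
  refine ⟨C * D, by positivity, fun r hr τ hτ => ?_⟩
  rw [abs_mul]
  calc |X r τ| * |Y r τ| ≤ (C * Real.exp (-(τ / 2))) * (D * Real.exp (-(τ / 2))) :=
        mul_le_mul (h1 r hr τ hτ) (h2 r hr τ hτ) (abs_nonneg _) (by positivity)
    _ = C * D * Real.exp (-τ) := by
        rw [mul_mul_mul_comm, ← Real.exp_add]; congr 2; ring
    _ ≤ C * D * Real.exp (-(η * τ)) := by gcongr; nlinarith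

lemma RapidDecay.add {X Y : ℝ → ℝ → ℝ} (hX : RapidDecay X) (hY : RapidDecay Y) :
    RapidDecay fun r τ => X r τ + Y r τ := by
  refine ⟨fun r hr => (hX.measurable r hr).add (hY.measurable r hr), fun η hη a b ha => ?_⟩
  obtain ⟨C, hC, h1⟩ := hX.bound η hη a b ha
  obtain ⟨D, hD, h2⟩ := hY.bound η hη a b ha
  refine ⟨C + D, by positivity, fun r hr τ hτ => ?_⟩
  rw [add_mul]
  exact (abs_add_le _ _).trans (add_le_add (h1 r hr τ hτ) (h2 r hr τ hτ))

lemma RapidDecay.coeff_mul {X : ℝ → ℝ → ℝ} (hX : RapidDecay X) {c : ℝ → ℝ}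
    (hc : ContinuousOn c (Ioi 0)) : RapidDecay fun r τ => c r * X r τ := by
  refine ⟨fun r hr => (hX.measurable r hr).const_mul _, fun η hη a b ha => ?_⟩
  obtain ⟨C, hC, h1⟩ := hX.bound η hη a b ha
  obtain ⟨D, hD⟩ := isCompact_Icc.exists_bound_of_continuousOn
    (hc.mono fun x (hx : x ∈ Icc a b) => lt_of_lt_of_le ha hx.1)
  refine ⟨|D| * C, by positivity, fun r hr τ hτ => ?_⟩
  rw [abs_mul, mul_assoc]
  exact mul_le_mul ((hD r hr).trans (le_abs_self D)) (h1 r hr τ hτ) (abs_nonneg _) (abs_nonneg _)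

lemma RapidDecay.const_mul {X : ℝ → ℝ → ℝ} (hX : RapidDecay X) (c : ℝ) :
    RapidDecay fun r τ => c * X r τ :=
  hX.coeff_mul (c := fun _ => c) continuousOn_const

lemma le_inv_mul_exp {δ : ℝ} (hδ : 0 < δ) (τ : ℝ) : τ ≤ δ⁻¹ * Real.exp (δ * τ) := by
  have h := Real.add_one_le_exp (δ * τ)
  calc τ = δ⁻¹ * (δ * τ) := by field_simp
    _ ≤ δ⁻¹ * Real.exp (δ * τ) := by gcongr; linarith

lemma RapidDecay.tau_mul {X : ℝ → ℝ → ℝ} (hX : RapidDecay X) :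
    RapidDecay fun r τ => τ * X r τ := by
  refine ⟨fun r hr => measurable_id.mul (hX.measurable r hr), fun η hη a b ha => ?_⟩
  obtain ⟨C, hC, h1⟩ := hX.bound ((η + 1) / 2) (by linarith) a b ha
  have hδ : 0 < (1 - η) / 2 := by linarith
  refine ⟨((1 - η) / 2)⁻¹ * C, by positivity, fun r hr τ hτ => ?_⟩
  rw [abs_mul, abs_of_pos hτ]
  calc τ * |X r τ| ≤ (((1 - η) / 2)⁻¹ * Real.exp ((1 - η) / 2 * τ)) *
        (C * Real.exp (-((η + 1) / 2 * τ))) :=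
        mul_le_mul (le_inv_mul_exp hδ τ) (h1 r hr τ hτ) (abs_nonneg _) (by positivity)
    _ = _ := by
        rw [mul_mul_mul_comm, ← Real.exp_add]; congr 2; ring

/-- The Bessel factor `A` of the kernel, up to a factor `2`. -/
noncomputable def kernelFactor (r τ : ℝ) : ℂ := besselMoment 0 (kernelArg r) τ

/-- The logarithmic derivative `4 r ∂A/∂r` of `kernelFactor`. -/
noncomputable def kernelFactorDeriv (r τ : ℝ) : ℂ :=
  (kernelArg r : ℂ) * besselMoment 1 (kernelArg r) τ

lemma hasDerivAt_kernelFactor {r : ℝ} (hr : 0 < r) (τ : ℝ) :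
    HasDerivAt (fun s => kernelFactor s τ) (kernelFactorDeriv r τ / (4 * r)) r := by
  have h := (hasDerivAt_besselMoment 0 (kernelArg_pos hr) τ).scomp r (hasDerivAt_kernelArg hr)
  refine h.congr_deriv ?_
  rw [kernelFactorDeriv, Complex.real_smul]
  push_cast
  ring

lemma hasDerivAt_kernelFactorDeriv {r : ℝ} (hr : 0 < r) (τ : ℝ) :
    HasDerivAt (fun s => kernelFactorDeriv s τ)
      ((Complex.I * (kernelArg r : ℂ) ^ 2 - 4 * (τ : ℂ) ^ 2) * kernelFactor r τ / (4 * r)) r := by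
  have hw := (hasDerivAt_kernelArg hr)
  have h := hw.ofReal_comp.mul
    ((hasDerivAt_besselMoment 1 (kernelArg_pos hr) τ).scomp r hw)
  refine h.congr_deriv ?_
  rw [kernelFactor, ← besselMoment_ode (kernelArg_pos hr), Complex.real_smul]
  simp only [Function.comp]
  push_cast
  ring

lemma kernelArg_mono {a r : ℝ} (ha : 0 < a) (h : a ≤ r) : kernelArg a ≤ kernelArg r := by
  unfold kernelArg
  gcongr

lemma exists_norm_kernelFactor_le (a b : ℝ) (ha : 0 < a) : ∃ C, 0 ≤ C ∧ ∀ r ∈ Icc a b, ∀ τ,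
    ‖kernelFactor r τ‖ ≤ C * Real.exp (-(τ / 2)) := by
  obtain ⟨C, hC, h⟩ := exists_norm_besselMoment_le 0 (kernelArg_pos ha)
  exact ⟨C, hC, fun r hr τ => h _ (kernelArg_mono ha hr.1) τ⟩

lemma exists_norm_kernelFactorDeriv_le (a b : ℝ) (ha : 0 < a) : ∃ C, 0 ≤ C ∧ ∀ r ∈ Icc a b, ∀ τ,
    ‖kernelFactorDeriv r τ‖ ≤ C * Real.exp (-(τ / 2)) := by
  obtain ⟨C, hC, h⟩ := exists_norm_besselMoment_le 1 (kernelArg_pos ha)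
  refine ⟨|kernelArg b| * C, by positivity, fun r hr τ => ?_⟩
  rw [kernelFactorDeriv, norm_mul, Complex.norm_real, Real.norm_eq_abs, mul_assoc,
    abs_of_pos (kernelArg_pos (ha.trans_le hr.1))]
  have h0 := kernelArg_pos (ha.trans_le hr.1)
  exact mul_le_mul ((kernelArg_mono (ha.trans_le hr.1) hr.2).trans (le_abs_self _))
    (h _ (kernelArg_mono ha hr.1) τ) (norm_nonneg _) (abs_nonneg _)

lemma measurable_kernelFactor (r : ℝ) : Measurable (kernelFactor r) :=
  measurable_besselMoment 0 _

lemma measurable_kernelFactorDeriv (r : ℝ) : Measurable (kernelFactorDeriv r) :=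
  (measurable_besselMoment 1 _).const_mul _

lemma halfDecay_kernelFactor_re : HalfDecay fun r τ => (kernelFactor r τ).re := by
  refine ⟨fun r _ => Complex.measurable_re.comp (measurable_kernelFactor r), fun a b ha => ?_⟩
  obtain ⟨C, hC, h⟩ := exists_norm_kernelFactor_le a b ha
  exact ⟨C, hC, fun r hr τ _ => (Complex.abs_re_le_norm _).trans (h r hr τ)⟩

lemma halfDecay_kernelFactor_im : HalfDecay fun r τ => (kernelFactor r τ).im := by
  refine ⟨fun r _ => Complex.measurable_im.comp (measurable_kernelFactor r), fun a b ha => ?_⟩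
  obtain ⟨C, hC, h⟩ := exists_norm_kernelFactor_le a b ha
  exact ⟨C, hC, fun r hr τ _ => (Complex.abs_im_le_norm _).trans (h r hr τ)⟩

lemma halfDecay_kernelFactorDeriv_re : HalfDecay fun r τ => (kernelFactorDeriv r τ).re := by
  refine ⟨fun r _ => Complex.measurable_re.comp (measurable_kernelFactorDeriv r),
    fun a b ha => ?_⟩
  obtain ⟨C, hC, h⟩ := exists_norm_kernelFactorDeriv_le a b ha
  exact ⟨C, hC, fun r hr τ _ => (Complex.abs_re_le_norm _).trans (h r hr τ)⟩

lemma halfDecay_kernelFactorDeriv_im : HalfDecay fun r τ => (kernelFactorDeriv r τ).im := by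
  refine ⟨fun r _ => Complex.measurable_im.comp (measurable_kernelFactorDeriv r),
    fun a b ha => ?_⟩
  obtain ⟨C, hC, h⟩ := exists_norm_kernelFactorDeriv_le a b ha
  exact ⟨C, hC, fun r hr τ _ => (Complex.abs_im_le_norm _).trans (h r hr τ)⟩

/-- `|A|²` in terms of `kernelFactor`; equal to the kernel for `r > 0`. -/
noncomputable def kernelP (r τ : ℝ) : ℝ :=
  1 / 4 * ((kernelFactor r τ).re * (kernelFactor r τ).re
    + (kernelFactor r τ).im * (kernelFactor r τ).im)

/-- The logarithmic derivative `4 r ∂(kernelP)/∂r`. -/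
noncomputable def kernelS (r τ : ℝ) : ℝ :=
  1 / 2 * ((kernelFactor r τ).re * (kernelFactorDeriv r τ).re
    + (kernelFactor r τ).im * (kernelFactorDeriv r τ).im)

/-- The squared modulus of the logarithmic derivative of the Bessel factor. -/
noncomputable def kernelQ (r τ : ℝ) : ℝ :=
  1 / 4 * ((kernelFactorDeriv r τ).re * (kernelFactorDeriv r τ).re
    + (kernelFactorDeriv r τ).im * (kernelFactorDeriv r τ).im)

/-- The Wronskian-type term closing the linear system for products of Bessel factors. -/
noncomputable def kernelT (r τ : ℝ) : ℝ :=
  1 / 2 * kernelArg r ^ 2 * ((kernelFactor r τ).re * (kernelFactorDeriv r τ).im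
    + (-1) * ((kernelFactor r τ).im * (kernelFactorDeriv r τ).re))

lemma kernelK_eq_kernelP {r : ℝ} (hr : 0 < r) (τ : ℝ) : kernelK r τ = kernelP r τ := by
  rw [kernelK_eq hr, Complex.normSq_apply, kernelP, kernelFactor]
  ring

lemma continuousOn_kernelArg : ContinuousOn kernelArg (Ioi 0) :=
  fun _ hr => (hasDerivAt_kernelArg hr).continuousAt.continuousWithinAt

lemma rapidDecay_kernelP : RapidDecay kernelP :=
  ((halfDecay_kernelFactor_re.mul halfDecay_kernelFactor_re).add
    (halfDecay_kernelFactor_im.mul halfDecay_kernelFactor_im)).const_mul _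

lemma rapidDecay_kernelS : RapidDecay kernelS :=
  ((halfDecay_kernelFactor_re.mul halfDecay_kernelFactorDeriv_re).add
    (halfDecay_kernelFactor_im.mul halfDecay_kernelFactorDeriv_im)).const_mul _

lemma rapidDecay_kernelQ : RapidDecay kernelQ :=
  ((halfDecay_kernelFactorDeriv_re.mul halfDecay_kernelFactorDeriv_re).add
    (halfDecay_kernelFactorDeriv_im.mul halfDecay_kernelFactorDeriv_im)).const_mul _

lemma rapidDecay_kernelT : RapidDecay kernelT :=
  ((halfDecay_kernelFactor_re.mul halfDecay_kernelFactorDeriv_im).add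
    ((halfDecay_kernelFactor_im.mul halfDecay_kernelFactorDeriv_re).const_mul (-1))).coeff_mul
    (c := fun r => 1 / 2 * kernelArg r ^ 2) ((continuousOn_kernelArg.pow 2).const_mul _)

lemma HasDerivAt.complex_re {f : ℝ → ℂ} {f' : ℂ} {x : ℝ} (h : HasDerivAt f f' x) :
    HasDerivAt (fun s => (f s).re) f'.re x :=
  (Complex.reCLM.hasFDerivAt.comp_hasDerivAt x h)

lemma HasDerivAt.complex_im {f : ℝ → ℂ} {f' : ℂ} {x : ℝ} (h : HasDerivAt f f' x) :
    HasDerivAt (fun s => (f s).im) f'.im x :=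
  (Complex.imCLM.hasFDerivAt.comp_hasDerivAt x h)

lemma hasDerivAt_kernelFactor_re {r : ℝ} (hr : 0 < r) (τ : ℝ) :
    HasDerivAt (fun s => (kernelFactor s τ).re) ((kernelFactorDeriv r τ).re / (4 * r)) r := by
  refine (hasDerivAt_kernelFactor hr τ).complex_re.congr_deriv ?_
  rw [show (4 * r : ℂ) = ((4 * r : ℝ) : ℂ) by push_cast; rfl, Complex.div_ofReal_re]

lemma hasDerivAt_kernelFactor_im {r : ℝ} (hr : 0 < r) (τ : ℝ) :
    HasDerivAt (fun s => (kernelFactor s τ).im) ((kernelFactorDeriv r τ).im / (4 * r)) r := by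
  refine (hasDerivAt_kernelFactor hr τ).complex_im.congr_deriv ?_
  rw [show (4 * r : ℂ) = ((4 * r : ℝ) : ℂ) by push_cast; rfl, Complex.div_ofReal_im]

lemma hasDerivAt_kernelFactorDeriv_re {r : ℝ} (hr : 0 < r) (τ : ℝ) :
    HasDerivAt (fun s => (kernelFactorDeriv s τ).re)
      ((-kernelArg r ^ 2 * (kernelFactor r τ).im - 4 * τ ^ 2 * (kernelFactor r τ).re)
        / (4 * r)) r := by
  refine (hasDerivAt_kernelFactorDeriv hr τ).complex_re.congr_deriv ?_
  rw [show (4 * r : ℂ) = ((4 * r : ℝ) : ℂ) by push_cast; rfl, Complex.div_ofReal_re,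
    show Complex.I * (kernelArg r : ℂ) ^ 2 - 4 * (τ : ℂ) ^ 2
      = ((-4 * τ ^ 2 : ℝ) : ℂ) + ((kernelArg r ^ 2 : ℝ) : ℂ) * Complex.I by push_cast; ring]
  simp only [Complex.add_re, Complex.mul_re, Complex.mul_im, Complex.add_im,
      Complex.ofReal_re, Complex.ofReal_im, Complex.I_re, Complex.I_im]
  ring

lemma hasDerivAt_kernelFactorDeriv_im {r : ℝ} (hr : 0 < r) (τ : ℝ) :
    HasDerivAt (fun s => (kernelFactorDeriv s τ).im)
      ((kernelArg r ^ 2 * (kernelFactor r τ).re - 4 * τ ^ 2 * (kernelFactor r τ).im)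
        / (4 * r)) r := by
  refine (hasDerivAt_kernelFactorDeriv hr τ).complex_im.congr_deriv ?_
  rw [show (4 * r : ℂ) = ((4 * r : ℝ) : ℂ) by push_cast; rfl, Complex.div_ofReal_im,
    show Complex.I * (kernelArg r : ℂ) ^ 2 - 4 * (τ : ℂ) ^ 2
      = ((-4 * τ ^ 2 : ℝ) : ℂ) + ((kernelArg r ^ 2 : ℝ) : ℂ) * Complex.I by push_cast; ring]
  simp only [Complex.add_re, Complex.mul_re, Complex.mul_im, Complex.add_im,
      Complex.ofReal_re, Complex.ofReal_im, Complex.I_re, Complex.I_im]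
  ring

lemma hasDerivAt_kernelP {r : ℝ} (hr : 0 < r) (τ : ℝ) :
    HasDerivAt (fun s => kernelP s τ) (kernelS r τ / (4 * r)) r := by
  have h1 := hasDerivAt_kernelFactor_re hr τ
  have h2 := hasDerivAt_kernelFactor_im hr τ
  refine (((h1.mul h1).add (h2.mul h2)).const_mul (1 / 4)).congr_deriv ?_
  rw [kernelS]
  ring

lemma hasDerivAt_kernelS {r : ℝ} (hr : 0 < r) (τ : ℝ) : HasDerivAt (fun s => kernelS s τ)
    ((-8 * τ ^ 2 * kernelP r τ + 2 * kernelQ r τ) / (4 * r)) r := by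
  have h1 := hasDerivAt_kernelFactor_re hr τ
  have h2 := hasDerivAt_kernelFactor_im hr τ
  have h3 := hasDerivAt_kernelFactorDeriv_re hr τ
  have h4 := hasDerivAt_kernelFactorDeriv_im hr τ
  refine (((h1.mul h3).add (h2.mul h4)).const_mul (1 / 2)).congr_deriv ?_
  rw [kernelP, kernelQ]
  ring

lemma hasDerivAt_kernelQ {r : ℝ} (hr : 0 < r) (τ : ℝ) : HasDerivAt (fun s => kernelQ s τ)
    ((-4 * τ ^ 2 * kernelS r τ + kernelT r τ) / (4 * r)) r := by
  have h3 := hasDerivAt_kernelFactorDeriv_re hr τ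
  have h4 := hasDerivAt_kernelFactorDeriv_im hr τ
  refine (((h3.mul h3).add (h4.mul h4)).const_mul (1 / 4)).congr_deriv ?_
  rw [kernelS, kernelT]
  ring

lemma hasDerivAt_kernelT {r : ℝ} (hr : 0 < r) (τ : ℝ) : HasDerivAt (fun s => kernelT s τ)
    ((2 * kernelT r τ + 128 * r * kernelP r τ) / (4 * r)) r := by
  have h1 := hasDerivAt_kernelFactor_re hr τ
  have h2 := hasDerivAt_kernelFactor_im hr τ
  have h3 := hasDerivAt_kernelFactorDeriv_re hr τ
  have h4 := hasDerivAt_kernelFactorDeriv_im hr τ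
  have hw := kernelArg_pow_four hr
  refine ((((hasDerivAt_kernelArg hr).pow 2).const_mul (1 / 2)).mul
    ((h1.mul h4).add ((h2.mul h3).const_mul (-1)))).congr_deriv ?_
  rw [kernelT, kernelP]
  simp only [Pi.add_apply, Pi.mul_apply, Pi.pow_apply]
  field_simp
  linear_combination 4 * ((kernelFactor r τ).re ^ 2 + (kernelFactor r τ).im ^ 2) * hw

/-- `∂𝒦/∂r`. -/
noncomputable def kernelD1 (r τ : ℝ) : ℝ := 1 / (4 * r) * kernelS r τ

/-- `∂²𝒦/∂r²`. -/
noncomputable def kernelD2 (r τ : ℝ) : ℝ :=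
  1 / (16 * r ^ 2) * (-8 * (τ * (τ * kernelP r τ)) + (2 * kernelQ r τ + -4 * kernelS r τ))

/-- `∂³𝒦/∂r³`. -/
noncomputable def kernelD3 (r τ : ℝ) : ℝ :=
  1 / (64 * r ^ 3) * (-16 * (τ * (τ * kernelS r τ)) + (2 * kernelT r τ
    + (96 * (τ * (τ * kernelP r τ)) + (-24 * kernelQ r τ + 32 * kernelS r τ))))

/-- `∂⁴𝒦/∂r⁴`, expressed through the lower derivatives by the fourth-order equation. -/
noncomputable def kernelD4 (r τ : ℝ) : ℝ :=
  1 / r ^ 3 * (-(11 / 2) * r ^ 2 * kernelD3 r τ + (-(11 / 2) * r * kernelD2 r τ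
    + (-(1 / 2) * kernelD1 r τ + (kernelP r τ
    + (-r * (τ * (τ * kernelD2 r τ)) + -(1 / 2) * (τ * (τ * kernelD1 r τ)))))))

lemma continuousOn_one_div_mul_pow {c : ℝ} (hc : c ≠ 0) (n : ℕ) :
    ContinuousOn (fun r : ℝ => 1 / (c * r ^ n)) (Ioi 0) :=
  continuousOn_const.div (by fun_prop) fun r hr => by
    have : r ≠ 0 := (mem_Ioi.1 hr).ne'
    positivity

lemma rapidDecay_kernelD1 : RapidDecay kernelD1 := by
  have h := continuousOn_one_div_mul_pow (c := 4) (by norm_num) 1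
  simp only [pow_one] at h
  exact rapidDecay_kernelS.coeff_mul h

lemma rapidDecay_kernelD2 : RapidDecay kernelD2 :=
  ((rapidDecay_kernelP.tau_mul.tau_mul.const_mul _).add
    ((rapidDecay_kernelQ.const_mul _).add (rapidDecay_kernelS.const_mul _))).coeff_mul
    (continuousOn_one_div_mul_pow (by norm_num) 2)

lemma rapidDecay_kernelD3 : RapidDecay kernelD3 :=
  ((rapidDecay_kernelS.tau_mul.tau_mul.const_mul _).add ((rapidDecay_kernelT.const_mul _).add
    ((rapidDecay_kernelP.tau_mul.tau_mul.const_mul _).add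
    ((rapidDecay_kernelQ.const_mul _).add (rapidDecay_kernelS.const_mul _))))).coeff_mul
    (continuousOn_one_div_mul_pow (by norm_num) 3)

lemma rapidDecay_kernelD4 : RapidDecay kernelD4 := by
  have h := continuousOn_one_div_mul_pow (c := 1) (by norm_num) 3
  simp only [one_mul] at h
  exact ((rapidDecay_kernelD3.coeff_mul (c := fun r => -(11 / 2) * r ^ 2) (by fun_prop)).add
    ((rapidDecay_kernelD2.coeff_mul (c := fun r => -(11 / 2) * r) (by fun_prop)).add
    ((rapidDecay_kernelD1.const_mul _).add (rapidDecay_kernelP.add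
    ((rapidDecay_kernelD2.tau_mul.tau_mul.coeff_mul (c := fun r => -r) (by fun_prop)).add
    (rapidDecay_kernelD1.tau_mul.tau_mul.const_mul _)))))).coeff_mul h

lemma hasDerivAt_kernelP' {r : ℝ} (hr : 0 < r) (τ : ℝ) :
    HasDerivAt (fun s => kernelP s τ) (kernelD1 r τ) r := by
  refine (hasDerivAt_kernelP hr τ).congr_deriv ?_
  rw [kernelD1]
  ring

lemma hasDerivAt_one_div_mul_pow {c : ℝ} (hc : c ≠ 0) (n : ℕ) {r : ℝ} (hr : 0 < r) :
    HasDerivAt (fun s : ℝ => 1 / (c * s ^ n)) (-(n / (c * r ^ (n + 1)))) r := by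
  have h := ((hasDerivAt_pow n r).const_mul c).fun_inv (by positivity)
  simp only [one_div]
  refine h.congr_deriv ?_
  cases n with
  | zero => simp
  | succ m =>
    simp only [Nat.add_sub_cancel]
    push_cast
    field_simp
    ring

lemma hasDerivAt_kernelD1 {r : ℝ} (hr : 0 < r) (τ : ℝ) :
    HasDerivAt (fun s => kernelD1 s τ) (kernelD2 r τ) r := by
  have hc := hasDerivAt_one_div_mul_pow (c := 4) (by norm_num) 1 hr
  simp only [pow_one] at hc
  refine (hc.mul (hasDerivAt_kernelS hr τ)).congr_deriv ?_
  rw [kernelD2]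
  push_cast
  field_simp
  ring

lemma hasDerivAt_kernelD2 {r : ℝ} (hr : 0 < r) (τ : ℝ) :
    HasDerivAt (fun s => kernelD2 s τ) (kernelD3 r τ) r := by
  have hP := hasDerivAt_kernelP hr τ
  have hS := hasDerivAt_kernelS hr τ
  have hQ := hasDerivAt_kernelQ hr τ
  refine ((hasDerivAt_one_div_mul_pow (c := 16) (by norm_num) 2 hr).mul
    ((((hP.const_mul τ).const_mul τ).const_mul (-8)).add
      ((hQ.const_mul 2).add (hS.const_mul (-4))))).congr_deriv ?_
  rw [kernelD3]
  simp only [Pi.add_apply]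
  push_cast
  field_simp
  ring

lemma hasDerivAt_kernelD3 {r : ℝ} (hr : 0 < r) (τ : ℝ) :
    HasDerivAt (fun s => kernelD3 s τ) (kernelD4 r τ) r := by
  have hP := hasDerivAt_kernelP hr τ
  have hS := hasDerivAt_kernelS hr τ
  have hQ := hasDerivAt_kernelQ hr τ
  have hT := hasDerivAt_kernelT hr τ
  refine ((hasDerivAt_one_div_mul_pow (c := 64) (by norm_num) 3 hr).mul
    ((((hS.const_mul τ).const_mul τ).const_mul (-16)).add ((hT.const_mul 2).add
      ((((hP.const_mul τ).const_mul τ).const_mul 96).add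
      ((hQ.const_mul (-24)).add (hS.const_mul 32)))))).congr_deriv ?_
  rw [kernelD4, kernelD3, kernelD2, kernelD1]
  simp only [Pi.add_apply]
  push_cast
  field_simp
  ring

/-- `v` is measurable and `O(exp (τ/2) |g τ|)` on `τ > 0`. -/
structure AdmissibleWeight (g v : ℝ → ℝ) : Prop where
  measurable : Measurable v
  bound : ∃ C, 0 ≤ C ∧ ∀ τ, 0 < τ → |v τ| ≤ C * Real.exp (τ / 2) * |g τ|

lemma abs_mul_le_of_exp_bounds {x y C D τ G : ℝ} (hC : 0 ≤ C)
    (hx : |x| ≤ C * Real.exp (-(1 / 2 * τ))) (hy : |y| ≤ D * Real.exp (τ / 2) * G) :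
    ‖x * y‖ ≤ C * D * G := by
  rw [Real.norm_eq_abs, abs_mul]
  calc |x| * |y| ≤ (C * Real.exp (-(1 / 2 * τ))) * (D * Real.exp (τ / 2) * G) :=
        mul_le_mul hx hy (abs_nonneg _) (by positivity)
    _ = C * D * G * (Real.exp (-(1 / 2 * τ)) * Real.exp (τ / 2)) := by ring
    _ = C * D * G := by
        rw [← Real.exp_add, show -(1 / 2 * τ) + τ / 2 = 0 by ring, Real.exp_zero, mul_one]

lemma RapidDecay.integrableOn_mul {X : ℝ → ℝ → ℝ} (hX : RapidDecay X) {g v : ℝ → ℝ}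
    (hg : IntegrableOn g (Ioi 0)) (hv : AdmissibleWeight g v) {r : ℝ} (hr : 0 < r) :
    IntegrableOn (fun τ => X r τ * v τ) (Ioi 0) := by
  obtain ⟨C, hC, h1⟩ := hX.bound (1 / 2) (by norm_num) r r hr
  obtain ⟨D, hD, h2⟩ := hv.bound
  refine Integrable.mono' (hg.abs.const_mul (C * D))
    ((hX.measurable r hr).mul hv.measurable).aestronglyMeasurable ?_
  filter_upwards [ae_restrict_mem measurableSet_Ioi] with τ hτ
  exact abs_mul_le_of_exp_bounds hC (h1 r ⟨le_rfl, le_rfl⟩ τ hτ) (h2 τ hτ)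

lemma RapidDecay.hasDerivAt_integral {X X' : ℝ → ℝ → ℝ} (hX : RapidDecay X)
    (hX' : RapidDecay X')
    (hd : ∀ r, 0 < r → ∀ τ, HasDerivAt (fun s => X s τ) (X' r τ) r) {g v : ℝ → ℝ}
    (hg : IntegrableOn g (Ioi 0)) (hv : AdmissibleWeight g v) {r : ℝ} (hr : 0 < r) :
    HasDerivAt (fun s => ∫ τ in Ioi (0 : ℝ), X s τ * v τ)
      (∫ τ in Ioi (0 : ℝ), X' r τ * v τ) r := by
  obtain ⟨C, hC, h1⟩ := hX'.bound (1 / 2) (by norm_num) (r / 2) (2 * r) (by positivity)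
  obtain ⟨D, hD, h2⟩ := hv.bound
  refine (hasDerivAt_integral_of_dominated_loc_of_deriv_le
    (μ := volume.restrict (Ioi 0)) (F := fun s τ => X s τ * v τ)
    (F' := fun s τ => X' s τ * v τ) (bound := fun τ => C * D * |g τ|)
    (Icc_mem_nhds (a := r / 2) (b := 2 * r) (by linarith) (by linarith)) ?_
    (hX.integrableOn_mul hg hv hr) (hX'.integrableOn_mul hg hv hr).aestronglyMeasurable ?_
    (hg.abs.const_mul _) ?_).2
  · filter_upwards [Ioi_mem_nhds hr] with s hs
    exact (hX.integrableOn_mul hg hv hs).aestronglyMeasurable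
  · filter_upwards [ae_restrict_mem measurableSet_Ioi] with τ hτ s hs
    exact abs_mul_le_of_exp_bounds hC (h1 s hs τ hτ) (h2 τ hτ)
  · refine Eventually.of_forall fun τ s hs => (hd s ?_ τ).mul_const _
    linarith [hs.1]

/-- The fourth-order equation for the kernel, integrated against a weight. -/
lemma pow_three_mul_integral_kernelD4 {g v w : ℝ → ℝ} (hg : IntegrableOn g (Ioi 0))
    (hv : AdmissibleWeight g v) (hw : AdmissibleWeight g w) (hvw : ∀ τ, w τ = τ * τ * v τ)
    {r : ℝ} (hr : 0 < r) :
    r ^ 3 * ∫ τ in Ioi (0 : ℝ), kernelD4 r τ * v τ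
      = -(11 / 2) * r ^ 2 * (∫ τ in Ioi (0 : ℝ), kernelD3 r τ * v τ)
        - 11 / 2 * r * (∫ τ in Ioi (0 : ℝ), kernelD2 r τ * v τ)
        - 1 / 2 * (∫ τ in Ioi (0 : ℝ), kernelD1 r τ * v τ)
        + (∫ τ in Ioi (0 : ℝ), kernelP r τ * v τ)
        - r * (∫ τ in Ioi (0 : ℝ), kernelD2 r τ * w τ)
        - 1 / 2 * (∫ τ in Ioi (0 : ℝ), kernelD1 r τ * w τ) := by
  have i0 := rapidDecay_kernelP.integrableOn_mul hg hv hr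
  have i1 := (rapidDecay_kernelD1.integrableOn_mul hg hv hr).const_mul (1 / 2)
  have i2 := (rapidDecay_kernelD2.integrableOn_mul hg hv hr).const_mul (11 / 2 * r)
  have i3 := (rapidDecay_kernelD3.integrableOn_mul hg hv hr).const_mul (-(11 / 2) * r ^ 2)
  have j1 := (rapidDecay_kernelD1.integrableOn_mul hg hw hr).const_mul (1 / 2)
  have j2 := (rapidDecay_kernelD2.integrableOn_mul hg hw hr).const_mul r
  simp only [← integral_const_mul]
  rw [← integral_sub' i3 i2, ← integral_sub' (i3.sub i2) i1, ← integral_add' ((i3.sub i2).sub i1) i0,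
    ← integral_sub' (((i3.sub i2).sub i1).add i0) j2,
    ← integral_sub' ((((i3.sub i2).sub i1).add i0).sub j2) j1]
  refine integral_congr_ae (Eventually.of_forall fun τ => ?_)
  simp only [kernelD4, hvw, Pi.add_apply, Pi.sub_apply]
  field_simp
  ring

lemma iteratedDeriv_eq_of_hasDerivAt_chain {U : Set ℝ} (hU : IsOpen U) (f : ℕ → ℝ → ℝ) (N : ℕ)
    (hf : ∀ n < N, ∀ x ∈ U, HasDerivAt (f n) (f (n + 1) x) x) :
    ∀ n ≤ N, ∀ x ∈ U, iteratedDeriv n (f 0) x = f n x := by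
  intro n
  induction n with
  | zero => intro _ x _; simp
  | succ n ih =>
    intro hn x hx
    rw [iteratedDeriv_succ]
    have he : iteratedDeriv n (f 0) =ᶠ[nhds x] f n := by
      filter_upwards [hU.mem_nhds hx] with y hy
      exact ih (by omega) y hy
    rw [he.deriv_eq]
    exact (hf n (by omega) x hx).deriv

lemma sinh_le_mul_exp {x : ℝ} : Real.sinh x ≤ x * Real.exp x := by
  rw [Real.sinh_eq]
  have h := Real.add_one_le_exp (-(2 * x))
  have h2 : Real.exp (-x) = Real.exp x * Real.exp (-(2 * x)) := by
    rw [← Real.exp_add]; congr 1; ring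
  rw [h2]
  nlinarith [Real.exp_pos x]

lemma mul_exp_le_sinh {x : ℝ} : x * Real.exp x ≤ (1 + 2 * x) * Real.sinh x := by
  rw [Real.sinh_eq]
  have h := Real.add_one_le_exp (2 * x)
  have h2 : Real.exp x = Real.exp (-x) * Real.exp (2 * x) := by
    rw [← Real.exp_add]; congr 1; ring
  rw [h2]
  nlinarith [Real.exp_pos (-x)]

lemma abs_sinh_mul_le {B θ τ : ℝ} (hθ : |θ| ≤ B) (hτ : 0 < τ) :
    |Real.sinh (θ * τ)| ≤ B * τ * Real.exp (B * τ) := by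
  have h1 : |θ| * τ ≤ B * τ := by gcongr
  rw [Real.abs_sinh, abs_mul, abs_of_pos hτ]
  exact (Real.sinh_le_sinh.2 h1).trans sinh_le_mul_exp

lemma abs_cosh_mul_le {B θ τ : ℝ} (hθ : |θ| ≤ B) (hτ : 0 < τ) :
    |Real.cosh (θ * τ)| ≤ Real.exp (B * τ) := by
  have h1 : |θ| * τ ≤ B * τ := by gcongr
  rw [abs_of_pos (Real.cosh_pos _), ← Real.cosh_abs, abs_mul, abs_of_pos hτ]
  refine le_trans ?_ (Real.exp_le_exp.2 h1)
  rw [Real.cosh_eq]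
  have : Real.exp (-(|θ| * τ)) ≤ Real.exp (|θ| * τ) := by
    rw [Real.exp_le_exp]
    have : 0 ≤ |θ| * τ := by positivity
    linarith
  linarith

lemma exists_mul_exp_div_sinh_le {β : ℝ} (hβ : 0 < β) : ∃ C, 0 ≤ C ∧ ∀ τ, 0 < τ →
    τ * Real.exp ((β + 1 / 4) * τ) / Real.sinh (β * τ) ≤ C * Real.exp (3 / 8 * τ) := by
  refine ⟨1 / β + 16, by positivity, fun τ hτ => ?_⟩
  have hs : 0 < Real.sinh (β * τ) := Real.sinh_pos_iff.2 (by positivity)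
  rw [div_le_iff₀ hs]
  have h1 := mul_exp_le_sinh (x := β * τ)
  have h2 : τ ≤ 8 * Real.exp (1 / 8 * τ) := by
    have := le_inv_mul_exp (δ := 1 / 8) (by norm_num) τ
    norm_num at this ⊢
    exact this
  have h3 : 1 ≤ Real.exp (1 / 8 * τ) := Real.one_le_exp (by positivity)
  have h4 : 1 / β + 2 * τ ≤ (1 / β + 16) * Real.exp (1 / 8 * τ) := by
    have : 1 / β ≤ 1 / β * Real.exp (1 / 8 * τ) := le_mul_of_one_le_right (by positivity) h3
    linarith
  calc τ * Real.exp ((β + 1 / 4) * τ)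
      = 1 / β * (β * τ * Real.exp (β * τ)) * Real.exp (1 / 4 * τ) := by
        rw [add_mul, Real.exp_add]; field_simp
    _ ≤ 1 / β * ((1 + 2 * (β * τ)) * Real.sinh (β * τ)) * Real.exp (1 / 4 * τ) := by gcongr
    _ = (1 / β + 2 * τ) * Real.exp (1 / 4 * τ) * Real.sinh (β * τ) := by field_simp
    _ ≤ ((1 / β + 16) * Real.exp (1 / 8 * τ)) * Real.exp (1 / 4 * τ) * Real.sinh (β * τ) := by
        gcongr
    _ = (1 / β + 16) * Real.exp (3 / 8 * τ) * Real.sinh (β * τ) := by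
        rw [mul_assoc (1 / β + 16), ← Real.exp_add]; congr 3; ring

/-- The `j`-th `θ`-derivative (`j ≤ 2`) of `sinh (θτ) / sinh (βτ)`. -/
noncomputable def wedgeRatio (β : ℝ) (j : ℕ) (θ τ : ℝ) : ℝ :=
  τ ^ j * (if Even j then Real.sinh (θ * τ) else Real.cosh (θ * τ)) / Real.sinh (β * τ)

lemma hasDerivAt_wedgeRatio (β : ℝ) (j : ℕ) (θ τ : ℝ) :
    HasDerivAt (fun φ => wedgeRatio β j φ τ) (wedgeRatio β (j + 1) θ τ) θ := by
  unfold wedgeRatio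
  rcases Nat.even_or_odd j with h | h
  · have h' : ¬ Even (j + 1) := by simpa [Nat.even_add_one] using h
    simp only [h, h', if_true, if_false]
    refine ((((hasDerivAt_id θ).mul_const τ).sinh).const_mul (τ ^ j) |>.div_const
      (Real.sinh (β * τ))).congr_deriv ?_
    simp only [id, one_mul]
    ring
  · have h' : Even (j + 1) := by simpa [Nat.even_add_one] using h
    simp only [Nat.not_even_iff_odd.2 h, h', if_true, if_false]
    refine ((((hasDerivAt_id θ).mul_const τ).cosh).const_mul (τ ^ j) |>.div_const
      (Real.sinh (β * τ))).congr_deriv ?_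
    simp only [id, one_mul]
    ring

lemma measurable_wedgeRatio (β : ℝ) (j : ℕ) (θ : ℝ) : Measurable (wedgeRatio β j θ) := by
  unfold wedgeRatio
  split_ifs <;> fun_prop

lemma exists_abs_wedgeRatio_le {β : ℝ} (hβ : 0 < β) {j : ℕ} (hj : j ≤ 2) :
    ∃ C, 0 ≤ C ∧ ∀ θ, |θ| ≤ β + 1 / 4 → ∀ τ, 0 < τ →
      |wedgeRatio β j θ τ| ≤ C * Real.exp (τ / 2) := by
  obtain ⟨C, hC, hb⟩ := exists_mul_exp_div_sinh_le hβ
  have hτ2 : ∀ τ : ℝ, τ * τ ≤ 16 ^ 2 * Real.exp (1 / 8 * τ) ∨ τ ≤ 0 := fun τ => by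
    rcases le_or_gt τ 0 with h | h
    · exact Or.inr h
    · refine Or.inl ?_
      have := le_inv_mul_exp (δ := 1 / 16) (by norm_num) τ
      calc τ * τ ≤ ((1 / 16)⁻¹ * Real.exp (1 / 16 * τ)) * ((1 / 16)⁻¹ * Real.exp (1 / 16 * τ)) :=
            mul_le_mul this this h.le (by positivity)
        _ = _ := by
            rw [mul_mul_mul_comm, ← Real.exp_add]; norm_num; ring_nf
  refine ⟨(β + 1 + 16 ^ 2 * (β + 1)) * C, by positivity, fun θ hθ τ hτ => ?_⟩
  have hs : 0 < Real.sinh (β * τ) := Real.sinh_pos_iff.2 (by positivity)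
  have h1 := abs_sinh_mul_le hθ hτ
  have h2 := abs_cosh_mul_le hθ hτ
  have h3 := (hτ2 τ).resolve_right hτ.not_ge
  have h0 := hb τ hτ
  have he : Real.exp (3 / 8 * τ) * Real.exp (1 / 8 * τ) = Real.exp (τ / 2) := by
    rw [← Real.exp_add]; congr 1; ring
  have he1 : 1 ≤ Real.exp (1 / 8 * τ) := Real.one_le_exp (by positivity)
  set W := τ * Real.exp ((β + 1 / 4) * τ) / Real.sinh (β * τ) with hW
  have hW0 : 0 ≤ W := by positivity
  have key : ∀ K L, 0 ≤ K → |wedgeRatio β j θ τ| ≤ K * W → K ≤ L * Real.exp (1 / 8 * τ) →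
      L ≤ β + 1 + 16 ^ 2 * (β + 1) →
      |wedgeRatio β j θ τ| ≤ (β + 1 + 16 ^ 2 * (β + 1)) * C * Real.exp (τ / 2) := by
    intro K L hK h hKL hL
    calc |wedgeRatio β j θ τ| ≤ K * W := h
      _ ≤ (L * Real.exp (1 / 8 * τ)) * (C * Real.exp (3 / 8 * τ)) :=
          mul_le_mul hKL h0 hW0 (hK.trans hKL)
      _ = L * C * Real.exp (τ / 2) := by rw [← he]; ring
      _ ≤ _ := by gcongr
  have hx : ∀ x : ℝ, |x / Real.sinh (β * τ)| = |x| / Real.sinh (β * τ) := fun x => by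
    rw [abs_div, abs_of_pos hs]
  interval_cases j
  · refine key (β + 1 / 4) (β + 1) (by positivity) ?_ (by nlinarith) (by nlinarith)
    simp only [wedgeRatio, pow_zero, one_mul, Even.zero, if_true, hx]
    rw [hW, mul_div_assoc', ← mul_assoc]
    exact div_le_div_of_nonneg_right h1 hs.le
  · refine key 1 1 (by positivity) ?_ (by linarith) (by nlinarith)
    simp only [wedgeRatio, pow_one, Nat.not_even_one, if_false, hx]
    rw [hW, one_mul, abs_mul, abs_of_pos hτ]
    gcongr
  · refine key (τ * τ * (β + 1 / 4)) (16 ^ 2 * (β + 1)) (by positivity) ?_ ?_ (by nlinarith)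
    · simp only [wedgeRatio, even_two, if_true, hx]
      rw [hW, mul_div_assoc', abs_mul, abs_of_pos (pow_pos hτ 2)]
      refine div_le_div_of_nonneg_right ?_ hs.le
      calc τ ^ 2 * |Real.sinh (θ * τ)|
          ≤ τ ^ 2 * ((β + 1 / 4) * τ * Real.exp ((β + 1 / 4) * τ)) := by gcongr
        _ = τ * τ * (β + 1 / 4) * (τ * Real.exp ((β + 1 / 4) * τ)) := by ring
    · calc τ * τ * (β + 1 / 4) ≤ (16 ^ 2 * Real.exp (1 / 8 * τ)) * (β + 1) :=
          mul_le_mul h3 (by linarith) (by positivity) (by positivity)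
        _ = _ := by ring

lemma admissibleWeight_wedgeRatio {β : ℝ} (hβ : 0 < β) {j : ℕ} (hj : j ≤ 2) {θ : ℝ}
    (hθ : |θ| ≤ β + 1 / 4) {g : ℝ → ℝ} (hg : Measurable g) :
    AdmissibleWeight g fun τ => wedgeRatio β j θ τ * g τ := by
  obtain ⟨C, hC, h⟩ := exists_abs_wedgeRatio_le hβ hj
  refine ⟨(measurable_wedgeRatio β j θ).mul hg, C, hC, fun τ hτ => ?_⟩
  rw [abs_mul]
  exact mul_le_mul_of_nonneg_right (h θ hθ τ hτ) (abs_nonneg _)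

lemma hasDerivAt_integral_wedgeRatio {X : ℝ → ℝ → ℝ} (hX : RapidDecay X) {g : ℝ → ℝ}
    (hgm : Measurable g) (hg : IntegrableOn g (Ioi 0)) {β : ℝ} (hβ : 0 < β) {j : ℕ}
    (hj : j + 1 ≤ 2) {r : ℝ} (hr : 0 < r) {θ : ℝ}
    (hθ : θ ∈ Ioo (-(β + 1 / 4)) (β + 1 / 4)) :
    HasDerivAt (fun φ => ∫ τ in Ioi (0 : ℝ), X r τ * (wedgeRatio β j φ τ * g τ))
      (∫ τ in Ioi (0 : ℝ), X r τ * (wedgeRatio β (j + 1) θ τ * g τ)) θ := by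
  obtain ⟨C, hC, h1⟩ := hX.bound (1 / 2) (by norm_num) r r hr
  obtain ⟨D, hD, h2⟩ := exists_abs_wedgeRatio_le hβ hj
  have integ : ∀ i ≤ 2, ∀ φ ∈ Ioo (-(β + 1 / 4)) (β + 1 / 4),
      IntegrableOn (fun τ => X r τ * (wedgeRatio β i φ τ * g τ)) (Ioi 0) := fun i hi φ hφ =>
    hX.integrableOn_mul hg
      (admissibleWeight_wedgeRatio hβ hi (abs_le.2 ⟨hφ.1.le, hφ.2.le⟩) hgm) hr
  refine (hasDerivAt_integral_of_dominated_loc_of_deriv_le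
    (μ := volume.restrict (Ioi 0)) (F := fun φ τ => X r τ * (wedgeRatio β j φ τ * g τ))
    (F' := fun φ τ => X r τ * (wedgeRatio β (j + 1) φ τ * g τ))
    (bound := fun τ => C * D * |g τ|) (Ioo_mem_nhds hθ.1 hθ.2) ?_
    (integ j (by omega) θ hθ) (integ (j + 1) hj θ hθ).aestronglyMeasurable ?_
    (hg.abs.const_mul _) ?_).2
  · filter_upwards [Ioo_mem_nhds hθ.1 hθ.2] with φ hφ
    exact (integ j (by omega) φ hφ).aestronglyMeasurable
  · filter_upwards [ae_restrict_mem measurableSet_Ioi] with τ hτ φ hφ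
    refine abs_mul_le_of_exp_bounds hC (h1 r ⟨le_rfl, le_rfl⟩ τ hτ) ?_
    rw [abs_mul]
    exact mul_le_mul_of_nonneg_right (h2 φ (abs_le.2 ⟨hφ.1.le, hφ.2.le⟩) τ hτ) (abs_nonneg _)
  · exact Eventually.of_forall fun τ φ _ =>
      ((hasDerivAt_wedgeRatio β j φ τ).mul_const _).const_mul _

lemma wedgeU_eq (g : ℝ → ℝ) (β : ℝ) {r : ℝ} (hr : 0 < r) (θ : ℝ) :
    wedgeU g β r θ = ∫ τ in Ioi (0 : ℝ), kernelP r τ * (wedgeRatio β 0 θ τ * g τ) := by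
  refine setIntegral_congr_fun measurableSet_Ioi fun τ hτ => ?_
  simp only [kernelK_eq_kernelP hr, if_neg (mem_Ioi.1 hτ).ne', wedgeRatio, pow_zero, one_mul,
    Even.zero, if_true, mul_assoc]

/-- Theorem 6: u(r,θ) solves the boundary value problem for equation (4.2) on the wedge
with u(r,0) = 0 and u(r,β) = (G g)(r). -/
theorem wedgeU_boundary_value_problem (g : ℝ → ℝ) (hgm : Measurable g)
    (hg : MeasureTheory.IntegrableOn (fun τ => |g τ| * (τ^2 + 1)) (Set.Ioi 0))
    (β : ℝ) (hβ1 : 0 < β) (hβ2 : β < 2*Real.pi) :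
    (∀ r : ℝ, 0 < r → ∀ θ ∈ Set.Icc (0:ℝ) β,
      r^3 * iteratedDeriv 4 (fun s => wedgeU g β s θ) r
        + r * iteratedDeriv 2 (fun s => iteratedDeriv 2 (fun φ => wedgeU g β s φ) θ) r
        + (11/2) * r^2 * iteratedDeriv 3 (fun s => wedgeU g β s θ) r
        + (1/2) * deriv (fun s => iteratedDeriv 2 (fun φ => wedgeU g β s φ) θ) r
        + (11/2) * r * iteratedDeriv 2 (fun s => wedgeU g β s θ) r
        + (1/2) * deriv (fun s => wedgeU g β s θ) r
        - wedgeU g β r θ = 0) ∧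
    (∀ r : ℝ, 0 < r → wedgeU g β r 0 = 0 ∧ wedgeU g β r β = indexG g r) := by
  have hgi : IntegrableOn g (Ioi 0) := by
    refine Integrable.mono hg hgm.aestronglyMeasurable (Eventually.of_forall fun τ => ?_)
    rw [norm_mul, Real.norm_eq_abs, Real.norm_eq_abs, Real.norm_eq_abs, abs_abs]
    exact le_mul_of_one_le_right (abs_nonneg _)
      (le_trans (by nlinarith [sq_nonneg τ]) (le_abs_self _))
  refine ⟨fun r hr θ hθ => ?_, fun r hr => ⟨?_, ?_⟩⟩
  · set B := β + 1 / 4 with hB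
    have hθB : θ ∈ Ioo (-B) B := ⟨by linarith [hθ.1], by linarith [hθ.2]⟩
    have hv : ∀ j ≤ 2, AdmissibleWeight g fun τ => wedgeRatio β j θ τ * g τ := fun j hj =>
      admissibleWeight_wedgeRatio hβ1 hj (abs_le.2 ⟨hθB.1.le, hθB.2.le⟩) hgm
    have hθ2 : ∀ s, 0 < s → iteratedDeriv 2 (fun φ => wedgeU g β s φ) θ
        = ∫ τ in Ioi (0 : ℝ), kernelP s τ * (wedgeRatio β 2 θ τ * g τ) := fun s hs => by
      rw [show (fun φ => wedgeU g β s φ) = fun φ => ∫ τ in Ioi (0 : ℝ),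
        kernelP s τ * (wedgeRatio β 0 φ τ * g τ) from funext fun φ => wedgeU_eq g β hs φ]
      exact iteratedDeriv_eq_of_hasDerivAt_chain isOpen_Ioo
        (fun j φ => ∫ τ in Ioi (0 : ℝ), kernelP s τ * (wedgeRatio β j φ τ * g τ)) 2
        (fun n hn φ hφ => hasDerivAt_integral_wedgeRatio rapidDecay_kernelP hgm hgi hβ1
          (by omega) hs hφ) 2 le_rfl θ hθB
    let D : ℕ → ℝ → ℝ → ℝ := fun n => match n with
      | 0 => kernelP | 1 => kernelD1 | 2 => kernelD2 | 3 => kernelD3 | _ => kernelD4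
    have hD : ∀ n, RapidDecay (D n) := fun n => match n with
      | 0 => rapidDecay_kernelP | 1 => rapidDecay_kernelD1 | 2 => rapidDecay_kernelD2
      | 3 => rapidDecay_kernelD3 | _ + 4 => rapidDecay_kernelD4
    have hDD : ∀ n < 4, ∀ s, 0 < s → ∀ τ,
        HasDerivAt (fun x => D n x τ) (D (n + 1) s τ) s := by
      intro n hn s hs τ
      interval_cases n
      · exact hasDerivAt_kernelP' hs τ
      · exact hasDerivAt_kernelD1 hs τ
      · exact hasDerivAt_kernelD2 hs τ
      · exact hasDerivAt_kernelD3 hs τ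
    have chain : ∀ j ≤ 2, ∀ f : ℝ → ℝ, (∀ s, 0 < s →
        f s = ∫ τ in Ioi (0 : ℝ), kernelP s τ * (wedgeRatio β j θ τ * g τ)) →
        ∀ n ≤ 4, iteratedDeriv n f r
          = ∫ τ in Ioi (0 : ℝ), D n r τ * (wedgeRatio β j θ τ * g τ) := by
      intro j hj f hf n hn
      have he : f =ᶠ[nhds r]
          fun s => ∫ τ in Ioi (0 : ℝ), D 0 s τ * (wedgeRatio β j θ τ * g τ) := by
        filter_upwards [Ioi_mem_nhds hr] with s hs using hf s hs
      rw [he.iteratedDeriv_eq]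
      exact iteratedDeriv_eq_of_hasDerivAt_chain isOpen_Ioi
        (fun n s => ∫ τ in Ioi (0 : ℝ), D n s τ * (wedgeRatio β j θ τ * g τ)) 4
        (fun n hn s hs => (hD n).hasDerivAt_integral (hD (n + 1)) (hDD n hn) hgi (hv j hj) hs)
        n hn r hr
    have c0 := chain 0 (by norm_num) (fun s => wedgeU g β s θ) fun s hs => wedgeU_eq g β hs θ
    have c2 := chain 2 le_rfl (fun s => iteratedDeriv 2 (fun φ => wedgeU g β s φ) θ) hθ2
    rw [← iteratedDeriv_one, ← iteratedDeriv_one, c0 4 le_rfl, c0 3 (by norm_num),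
      c0 2 (by norm_num), c0 1 (by norm_num), c2 2 (by norm_num), c2 1 (by norm_num),
      wedgeU_eq g β hr]
    change r ^ 3 * (∫ τ in Ioi (0 : ℝ), kernelD4 r τ * (wedgeRatio β 0 θ τ * g τ)) +
      r * (∫ τ in Ioi (0 : ℝ), kernelD2 r τ * (wedgeRatio β 2 θ τ * g τ)) +
      11 / 2 * r ^ 2 * (∫ τ in Ioi (0 : ℝ), kernelD3 r τ * (wedgeRatio β 0 θ τ * g τ)) +
      1 / 2 * (∫ τ in Ioi (0 : ℝ), kernelD1 r τ * (wedgeRatio β 2 θ τ * g τ)) +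
      11 / 2 * r * (∫ τ in Ioi (0 : ℝ), kernelD2 r τ * (wedgeRatio β 0 θ τ * g τ)) +
      1 / 2 * (∫ τ in Ioi (0 : ℝ), kernelD1 r τ * (wedgeRatio β 0 θ τ * g τ)) - _ = 0
    rw [pow_three_mul_integral_kernelD4 hgi (hv 0 (by norm_num)) (hv 2 le_rfl) (fun τ => by
      simp only [wedgeRatio, even_two, Even.zero, if_true]; ring) hr]
    ring
  · rw [wedgeU]
    simp
  · refine setIntegral_congr_fun measurableSet_Ioi fun τ hτ => ?_
    have h0 := mem_Ioi.1 hτ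
    have hs : Real.sinh (β * τ) ≠ 0 := (Real.sinh_pos_iff.2 (by positivity)).ne'
    simp only [if_neg h0.ne', div_self hs, mul_one]
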